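/- arXiv:1708.01957 — 2 statements merged into one kernel-verified Lean document; each statement's English description precedes it below -/
import Mathlib

section
/- For all integers L ≥ 3 and N ≥ 1, the number of partitions of N with smallest part 2, all parts ≤ L+2, and where L+1 does not occur as a part, plus the correction term δ_{N,3} + δ_{N,9}·δ_{L,4}, is at least the number of nonempty partitions of N into parts from {3, 4, ..., L+2}. -/
namespace BU

open PowerSeries

/-- Geometric series `1/(1-X^k)`. -/
noncomputable def E (k : ℕ) : PowerSeries ℤ := PowerSeries.mk fun n => if k ∣ n then 1 else 0

/-- Coefficientwise nonnegativity. -/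
def Nn (f : PowerSeries ℤ) : Prop := ∀ n, 0 ≤ PowerSeries.coeff n f

lemma Nn.add {f g : PowerSeries ℤ} (hf : Nn f) (hg : Nn g) : Nn (f + g) := fun n => by
  rw [map_add]; exact add_nonneg (hf n) (hg n)

lemma Nn.mul {f g : PowerSeries ℤ} (hf : Nn f) (hg : Nn g) : Nn (f * g) := fun n => by
  rw [PowerSeries.coeff_mul]; exact Finset.sum_nonneg fun p _ => mul_nonneg (hf _) (hg _)

lemma Nn.X (k : ℕ) : Nn (X ^ k) := fun n => by
  rw [PowerSeries.coeff_X_pow]; split_ifs <;> simp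

lemma Nn.one : Nn 1 := by simpa using Nn.X 0

lemma Nn.zero : Nn 0 := fun n => by simp

lemma Nn.E (k : ℕ) : Nn (E k) := fun n => by
  rw [BU.E, PowerSeries.coeff_mk]; split_ifs <;> simp

lemma Nn.sum {ι : Type} (s : Finset ι) (f : ι → PowerSeries ℤ) (h : ∀ i ∈ s, Nn (f i)) :
    Nn (∑ i ∈ s, f i) := fun n => by
  rw [map_sum]; exact Finset.sum_nonneg fun i hi => h i hi n

lemma E_mul (k : ℕ) (hk : 1 ≤ k) : E k * (1 - X ^ k) = 1 := by
  ext n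
  rw [mul_sub, mul_one, map_sub, PowerSeries.coeff_mul_X_pow', PowerSeries.coeff_one]
  simp only [E, PowerSeries.coeff_mk]
  by_cases h : k ≤ n
  · have h1 : k ∣ n - k ↔ k ∣ n := by
      constructor
      · intro h2
        have := Nat.dvd_add h2 (dvd_refl k)
        rwa [Nat.sub_add_cancel h] at this
      · intro h2; exact Nat.dvd_sub h2 (dvd_refl k)
    have h3 : n ≠ 0 := by omega
    simp [h, h1, h3]
  · by_cases h0 : n = 0
    · subst h0; simp; omega
    · have : ¬ k ∣ n := fun hd => h (Nat.le_of_dvd (by omega) hd)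
      simp [h, h0, this]

/-- `G L = 1/((1-X^3)...(1-X^(L+2)))`. -/
noncomputable def G : ℕ → PowerSeries ℤ
  | 0 => 1
  | L + 1 => G L * E (L + 3)

/-- `Q L = 1/((1-X^2)...(1-X^(L+2)))`. -/
noncomputable def Q (L : ℕ) : PowerSeries ℤ := E 2 * G L

noncomputable def F (L : ℕ) : PowerSeries ℤ := (1 - 2 * X ^ 2 + X ^ (L + 3)) * Q L
noncomputable def T (L : ℕ) : PowerSeries ℤ := (1 - 2 * X + X ^ (L + 1)) * Q L
noncomputable def U (L : ℕ) : PowerSeries ℤ := (1 - X - X ^ 2 + 2 * X ^ 3 - X ^ (L + 2)) * Q L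

lemma G_succ (L : ℕ) : G (L + 1) = G L * E (L + 3) := rfl

lemma Nn.G (L : ℕ) : Nn (G L) := by
  induction L with
  | zero => exact Nn.one
  | succ L ih => exact ih.mul (Nn.E _)

lemma G_eq (L : ℕ) : G L = G (L + 1) * (1 - X ^ (L + 3)) := by
  rw [G_succ, mul_assoc, E_mul _ (by omega), mul_one]

lemma F_succ (L : ℕ) : F (L + 1) = F L + X ^ (L + 4) * T (L + 1) := by
  simp only [F, T, Q]
  rw [G_eq L]
  ring

lemma T_succ (L : ℕ) : T (L + 1) = T L - X ^ (L + 1) * U (L + 1) := by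
  simp only [U, T, Q]
  rw [G_eq L]
  ring

lemma R_nonneg (L : ℕ) : Nn ((1 - X + X ^ (L + 3)) * G L - (1 - X)) := by
  induction L with
  | zero => 
    have : (1 - X + X ^ (0 + 3)) * G 0 - (1 - X) = (X ^ 3 : PowerSeries ℤ) := by
      simp only [G]; ring
    rw [this]; exact Nn.X 3
  | succ L ih =>
    have : (1 - X + X ^ (L + 1 + 3)) * G (L + 1) - (1 - X) =
      ((1 - X + X ^ (L + 3)) * G L - (1 - X)) + X ^ (2 * L + 6) * G (L + 1) := by
      rw [G_eq L]; ring
    rw [this]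
    exact ih.add ((Nn.X _).mul (Nn.G _))

lemma geom2 (s : ℕ) : (1 - X ^ (2 * s)) * E 2 = ∑ i ∈ Finset.range s, (X ^ (2 * i) : PowerSeries ℤ) := by
  induction s with
  | zero => simp
  | succ s ih =>
    rw [Finset.sum_range_succ, ← ih]
    linear_combination (X ^ (2 * s)) * E_mul 2 (by omega)

lemma geomSum_nonneg (s : ℕ) : Nn (∑ i ∈ Finset.range s, (X ^ (2 * i) : PowerSeries ℤ)) :=
  Nn.sum _ _ fun i _ => Nn.X _

/-- odd case -/
lemma K_odd (s L : ℕ) (hL : L = 2 * s + 3) : 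
    Nn (((1 - X ^ (L - 1)) * E 2 - X ^ L) * G L) := by
  subst hL
  have e1 : 2 * s + 3 - 1 = 2 * (s + 1) := by omega
  rw [e1, geom2, Finset.sum_range_succ']
  have h := E_mul (2 * s + 3) (by omega)
  have : (∑ k ∈ Finset.range s, X ^ (2 * (k + 1)) + X ^ (2 * 0) - X ^ (2 * s + 3)) * G (2 * s + 3)
    = (∑ k ∈ Finset.range s, X ^ (2 * (k + 1))) * G (2 * s + 3) + 
      G (2 * s) * E (2 * s + 4) * E (2 * s + 5) := by
    simp only [G_succ]
    linear_combination (G (2 * s) * E (2 * s + 4) * E (2 * s + 5)) * h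
  rw [this]
  refine ((Nn.sum _ _ fun i _ => Nn.X _).mul (Nn.G _)).add (((Nn.G _).mul (Nn.E _)).mul (Nn.E _))

/-- even case -/
lemma K_even (s L : ℕ) (hL : L = 2 * s + 4) : 
    Nn (((1 - X ^ (L - 1)) * E 2 - X ^ L) * G L) := by
  subst hL
  have e1 : 2 * s + 4 - 1 = 2 * s + 3 := by omega
  rw [e1]
  have h3 := E_mul (2 * s + 3) (by omega)
  have h5 := E_mul (2 * s + 5) (by omega)
  have h6 := E_mul (2 * (2 * s + 3)) (by omega)
  have h2 : E 2 = (∑ i ∈ Finset.range (2 * s + 3), X ^ (2 * i)) * E (2 * (2 * s + 3)) := by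
    rw [← geom2]
    linear_combination - E 2 * h6
  have h3' : E (2 * s + 3) = (1 + X ^ (2 * s + 3)) * E (2 * (2 * s + 3)) := by
    linear_combination (1 + X ^ (2 * s + 3)) * E (2 * (2 * s + 3)) * h3 - E (2 * s + 3) * h6
  have hs : ∑ i ∈ Finset.range (2 * s + 3), (X ^ (2 * i) : PowerSeries ℤ) = 
      ∑ i ∈ Finset.range (s + 1), (X ^ (2 * i) : PowerSeries ℤ) + X ^ (2 * s + 2) + X ^ (2 * s + 4)
      + ∑ i ∈ Finset.range s, (X ^ (2 * (s + 3 + i)) : PowerSeries ℤ) := by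
    rw [show 2 * s + 3 = (s + 1 + 1 + 1) + s by ring, Finset.sum_range_add,
      Finset.sum_range_succ, Finset.sum_range_succ]
    rfl
  have key : ((1 - X ^ (2 * s + 3)) * E 2 - X ^ (2 * s + 4)) * G (2 * s + 4) = 
      G (2 * s) * E (2 * s + 4) * E (2 * s + 6) * E (2 * (2 * s + 3)) * 
      ((∑ i ∈ Finset.range (s + 1), (X ^ (2 * i) : PowerSeries ℤ)
      + ∑ i ∈ Finset.range s, (X ^ (2 * (s + 3 + i)) : PowerSeries ℤ)) * E (2 * s + 5)
      + X ^ (2 * s + 2)) := by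
    have k1 : ((1 - X ^ (2 * s + 3)) * E 2 - X ^ (2 * s + 4)) * G (2 * s + 4) = 
       G (2 * s) * E (2 * s + 4) * E (2 * s + 5) * E (2 * s + 6) * 
        (E 2 - X ^ (2 * s + 4) * E (2 * s + 3)) := by
      simp only [G_succ]
      linear_combination (E 2 * G (2 * s) * E (2 * s + 4) * E (2 * s + 5) * E (2 * s + 6)) * h3
    rw [k1, h3', h2, hs]
    linear_combination (G (2 * s) * E (2 * s + 4) * E (2 * s + 6) * E (2 * (2 * s + 3)) * 
      X ^ (2 * s + 2)) * h5
  rw [key]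
  refine (((((Nn.G _).mul (Nn.E _)).mul (Nn.E _)).mul (Nn.E _))).mul ?_
  exact (((Nn.sum _ _ fun i _ => Nn.X _).add (Nn.sum _ _ fun i _ => Nn.X _)).mul (Nn.E _)).add
    (Nn.X _)

lemma U_ge (L : ℕ) (hL : 3 ≤ L) : Nn (U L - (1 - X)) := by
  have hK : Nn (((1 - X ^ (L - 1)) * E 2 - X ^ L) * G L) := by
    rcases Nat.even_or_odd' L with ⟨c, h | h⟩
    · exact K_even (c - 2) L (by omega)
    · exact K_odd (c - 1) L (by omega)
  have : U L - (1 - X) = ((1 - X + X ^ (L + 3)) * G L - (1 - X)) + 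
      X ^ 3 * (((1 - X ^ (L - 1)) * E 2 - X ^ L) * G L) := by
    obtain ⟨m, rfl⟩ : ∃ m, L = m + 1 := ⟨L - 1, by omega⟩
    simp only [U, Q, Nat.add_sub_cancel]
    linear_combination (1 - X) * G (m + 1) * E_mul 2 (by omega)
  rw [this]
  exact (R_nonneg L).add ((Nn.X _).mul hK)

lemma T_le (m : ℕ) : Nn (T 3 - X ^ 4 + X ^ (m + 4) - T (m + 3)) := by
  induction m with
  | zero => 
    have : T 3 - X ^ 4 + X ^ (0 + 4) - T (0 + 3) = 0 := by simp
    rw [this]; exact Nn.zero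
  | succ m ih =>
    have : T 3 - X ^ 4 + X ^ (m + 1 + 4) - T (m + 1 + 3) = 
      (T 3 - X ^ 4 + X ^ (m + 4) - T (m + 3)) + X ^ (m + 4) * (U (m + 4) - (1 - X)) := by
      have := T_succ (m + 3)
      rw [show m + 1 + 3 = m + 3 + 1 by ring, this]; ring
    rw [this]
    exact ih.add ((Nn.X _).mul (U_ge _ (by omega)))

lemma G3 : G 3 = E 3 * E 4 * E 5 := by simp [G]

lemma T3_le : Nn ((1 - X) * (1 - X + X ^ 8 + X ^ 12) - X ^ 3 + X ^ 4 - T 3) := by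
  have h2 := E_mul 2 (by omega)
  have h3 := E_mul 3 (by omega)
  have h4 := E_mul 4 (by omega)
  have h5 := E_mul 5 (by omega)
  have c4 : (X ^ 11 * (E 5 + X ^ 4 * E 4) : PowerSeries ℤ) = X ^ 11 * (1 - X ^ 9) * (E 4 * E 5) := by
    linear_combination (-X ^ 11 * E 5) * h4 - X ^ 15 * E 4 * h5
  have : (1 - X) * (1 - X + X ^ 8 + X ^ 12) - X ^ 3 + X ^ 4 - T 3 = 
     X ^ 5 + X ^ 5 * (E 2 * E 4) + X ^ 7 * (1 + X ^ 4) + X ^ 11 * (E 5 + X ^ 4 * E 4) + 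
     X ^ 13 * (1 + X ^ 2 + X ^ 4 + X ^ 6 + X ^ 8) * (E 4 * E 5) + X ^ 25 * (E 3 * E 4 * E 5) := by
    have d : (1 - X ^ 2 : PowerSeries ℤ) * (1 - X ^ 3) * (1 - X ^ 4) * (1 - X ^ 5) * 
      (E 2 * E 3 * E 4 * E 5) = 1 := by
      calc _ = (E 2 * (1 - X ^ 2)) * (E 3 * (1 - X ^ 3)) * (E 4 * (1 - X ^ 4)) * (E 5 * (1 - X ^ 5)) := by ring
        _ = 1 := by rw [h2, h3, h4, h5]; ring
    have d24 : E 2 * E 4 = (1 - X ^ 3) * (1 - X ^ 5) * (E 2 * E 3 * E 4 * E 5) := by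
      calc _ = (E 2 * E 4) * 1 * 1 := by ring
        _ = (E 2 * E 4) * (E 3 * (1 - X ^ 3)) * (E 5 * (1 - X ^ 5)) := by rw [h3, h5]
        _ = _ := by ring
    have d45 : E 4 * E 5 = (1 - X ^ 2) * (1 - X ^ 3) * (E 2 * E 3 * E 4 * E 5) := by
      calc _ = (E 4 * E 5) * 1 * 1 := by ring
        _ = (E 4 * E 5) * (E 2 * (1 - X ^ 2)) * (E 3 * (1 - X ^ 3)) := by rw [h2, h3]
        _ = _ := by ring
    have d345 : E 3 * E 4 * E 5 = (1 - X ^ 2) * (E 2 * E 3 * E 4 * E 5) := by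
      calc _ = (E 3 * E 4 * E 5) * 1 := by ring
        _ = (E 3 * E 4 * E 5) * (E 2 * (1 - X ^ 2)) := by rw [h2]
        _ = _ := by ring
    rw [c4, d24, d45, d345]
    simp only [T, Q, G3]
    linear_combination (-((1 - X) * (1 - X + X ^ 8 + X ^ 12) - X ^ 3 + X ^ 4 - X ^ 5 - X ^ 7 - X ^ 11)) * d
  rw [this]
  have hx := Nn.X
  have he := Nn.E
  refine (((((hx 5).add ((hx 5).mul ((he 2).mul (he 4)))).add ?_).add ?_).add ?_).add ?_
  · exact (hx _).mul (Nn.one.add (hx _))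
  · exact (hx _).mul ((he _).add ((hx _).mul (he _)))
  · exact ((hx _).mul ((((Nn.one.add (hx _)).add (hx _)).add (hx _)).add (hx _))).mul ((he _).mul (he _))
  · exact (hx _).mul (((he _).mul (he _)).mul (he _))

lemma F3_le : Nn (1 - X ^ 2 + X ^ 3 - X ^ 7 - X ^ 10 * E 1 - F 3) := by
  have h1 := E_mul 1 (by omega)
  have h2 := E_mul 2 (by omega)
  have h3 := E_mul 3 (by omega)
  have h4 := E_mul 4 (by omega)
  have h5 := E_mul 5 (by omega)
  have hF : F 3 = (1 - X ^ 2 - X ^ 4) * (E 3 * E 4 * E 5) := by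
    simp only [F, Q, G3]
    linear_combination (1 - X ^ 2 - X ^ 4) * (E 3 * E 4 * E 5) * h2
  have : 1 - X ^ 2 + X ^ 3 - X ^ 7 - X ^ 10 * E 1 - F 3 = 
     X ^ 14 * (E 3 * E 4 * E 5) + (X ^ 16 + X ^ 17) * (E 3 * E 5) := by
    have d : (1 - X ^ 3 : PowerSeries ℤ) * (1 - X ^ 4) * (1 - X ^ 5) * 
      (E 3 * E 4 * E 5) = 1 := by
      calc _ = (E 3 * (1 - X ^ 3)) * (E 4 * (1 - X ^ 4)) * (E 5 * (1 - X ^ 5)) := by ring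
        _ = 1 := by rw [h3, h4, h5]; ring
    have d35 : E 3 * E 5 = (1 - X ^ 4) * (E 3 * E 4 * E 5) := by
      linear_combination -E 3 * E 5 * h4
    have d1 : E 1 = (1 + X + X ^ 2) * ((1 - X ^ 4) * (1 - X ^ 5)) * (E 3 * E 4 * E 5) := by
      linear_combination (-E 1) * d + ((1 + X + X ^ 2) * ((1 - X ^ 4) * (1 - X ^ 5)) * (E 3 * E 4 * E 5)) * h1
    rw [hF, d35, d1]
    linear_combination (-(1 - X ^ 2 + X ^ 3 - X ^ 7)) * d
  rw [this]
  have hx := Nn.X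
  have he := Nn.E
  exact ((hx _).mul (((he _).mul (he _)).mul (he _))).add (((hx _).add (hx _)).mul ((he _).mul (he _)))

lemma F_le (m : ℕ) : Nn (F 3 + (X ^ 7 - X ^ (m + 7)) * (1 - X + X ^ 8 + X ^ 12)
    - ∑ i ∈ Finset.range m, X ^ (i + 10) + ∑ i ∈ Finset.range m, X ^ (2 * i + 12) - F (m + 3)) := by
  induction m with
  | zero => 
    have : F 3 + (X ^ 7 - X ^ (0 + 7)) * (1 - X + X ^ 8 + X ^ 12)
    - ∑ i ∈ Finset.range 0, X ^ (i + 10) + ∑ i ∈ Finset.range 0, X ^ (2 * i + 12) - F (0 + 3) = 0 := by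
      simp
    rw [this]; exact Nn.zero
  | succ m ih =>
    have h := (ih.add ((Nn.X (m + 7)).mul (T_le (m + 1)))).add ((Nn.X (m + 7)).mul T3_le)
    convert h using 1
    rw [Finset.sum_range_succ, Finset.sum_range_succ, show F (m + 1 + 3) = F (m + 3) + X ^ (m + 7) * T (m + 1 + 3) from F_succ (m + 3)]
    generalize F 3 = a
    generalize T 3 = b
    ring

lemma coeff_sum1 (m N : ℕ) : PowerSeries.coeff N (∑ i ∈ Finset.range m, (X ^ (i + 10) : PowerSeries ℤ))
    = if 10 ≤ N ∧ N < m + 10 then 1 else 0 := by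
  induction m with
  | zero => simp <;> omega
  | succ m ih =>
    rw [Finset.sum_range_succ, map_add, ih, PowerSeries.coeff_X_pow]
    split_ifs <;> omega

lemma coeff_sum2 (m N : ℕ) : PowerSeries.coeff N (∑ i ∈ Finset.range m, (X ^ (2 * i + 12) : PowerSeries ℤ))
    = if 12 ≤ N ∧ N < 2 * m + 12 ∧ N % 2 = 0 then 1 else 0 := by
  induction m with
  | zero => simp <;> omega
  | succ m ih =>
    rw [Finset.sum_range_succ, map_add, ih, PowerSeries.coeff_X_pow]
    split_ifs <;> omega

lemma coeff_F (m N : ℕ) (hN : 1 ≤ N) : PowerSeries.coeff N (F (m + 3)) ≤ 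
    (if N = 3 then 1 else 0) + (if N = 9 ∧ m + 3 = 4 then 1 else 0) := by
  have h1 := F_le m N
  have h2 := F3_le N
  have e : (F 3 + (X ^ 7 - X ^ (m + 7)) * (1 - X + X ^ 8 + X ^ 12)
    - ∑ i ∈ Finset.range m, X ^ (i + 10) + ∑ i ∈ Finset.range m, X ^ (2 * i + 12) - F (m + 3))
    = (F 3 + X ^ 7 - X ^ 8 + X ^ 15 + X ^ 19 - X ^ (m + 7) + X ^ (m + 8) - X ^ (m + 15) - X ^ (m + 19)
    - ∑ i ∈ Finset.range m, X ^ (i + 10) + ∑ i ∈ Finset.range m, X ^ (2 * i + 12) - F (m + 3)) := by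
    ring
  rw [e] at h1
  simp only [map_add, map_sub, coeff_sum1, coeff_sum2, PowerSeries.coeff_X_pow,
    PowerSeries.coeff_X_pow_mul', PowerSeries.coeff_one, E, PowerSeries.coeff_mk, one_dvd,
    if_true] at h1 h2
  generalize PowerSeries.coeff N (F 3) = a at *
  generalize PowerSeries.coeff N (F (m + 3)) = b at *
  by_cases h10 : 10 ≤ N
  · simp only [h10, if_true, show N ≠ 0 by omega, show N ≠ 2 by omega, show N ≠ 3 by omega, 
      show N ≠ 7 by omega, show N ≠ 8 by omega, show N ≠ 9 by omega, if_false, false_and, true_and] at h1 h2 ⊢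
    split_ifs at h1 <;> omega
  · have : ∀ k, 10 ≤ k → N ≠ k := by omega
    simp only [h10, this 15 (by omega), this 19 (by omega), this (m + 15) (by omega), 
      this (m + 19) (by omega), show ¬ 12 ≤ N by omega, if_false, false_and] at h1 h2 ⊢
    split_ifs at h1 h2 ⊢ <;> omega

section bridge
open scoped PowerSeries.WithPiTopology
open Nat.Partition

lemma E_tsum (k : ℕ) (hk : 1 ≤ k) : ∑' j : ℕ, (X ^ (k * j) : PowerSeries ℤ) = E k := by
  have h : (∑' j : ℕ, (X ^ (k * j) : PowerSeries ℤ)) * (1 - X ^ k) = 1 := by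
    simp_rw [pow_mul]
    exact PowerSeries.WithPiTopology.tsum_pow_mul_one_sub_of_constantCoeff_eq_zero (by simp; omega)
  linear_combination (E k) * h - (∑' j : ℕ, (X ^ (k * j) : PowerSeries ℤ)) * E_mul k hk

lemma card_restricted (S : Finset ℕ) (p : ℕ → Prop) [DecidablePred p] (hS : ∀ i, 1 ≤ i → (p i ↔ i ∈ S))
    (h0 : 0 ∉ S) (N : ℕ) : ((Nat.Partition.restricted N p).card : ℤ) = 
    PowerSeries.coeff N (∏ k ∈ S, E k) := by
  have h := Nat.Partition.hasProd_powerSeriesMk_card_restricted ℤ p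
  have h' : HasProd (fun i ↦ if p (i + 1) then ∑' j : ℕ, (X ^ ((i + 1) * j) : PowerSeries ℤ) else 1)
    (∏ k ∈ S, E k) := by
    have e : ∏ k ∈ S, E k = ∏ i ∈ S.image (fun k => k - 1), 
      (if p (i + 1) then ∑' j : ℕ, (X ^ ((i + 1) * j) : PowerSeries ℤ) else 1) := by
      have hp : ∀ k ∈ S, 1 ≤ k := fun k hk => by
        rcases Nat.eq_zero_or_pos k with h | h
        · subst h; exact absurd hk h0
        · exact h
      rw [Finset.prod_image]
      · apply Finset.prod_congr rfl
        intro k hk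
        have := hp k hk
        rw [Nat.sub_add_cancel this, if_pos ((hS k this).2 hk), E_tsum k this]
      · intro a ha b hb hab
        have := hp a ha
        have := hp b hb
        simp only at hab
        omega
    rw [e]
    apply hasProd_prod_of_ne_finset_one
    intro b hb
    rw [if_neg]
    intro hpb
    exact hb (Finset.mem_image.2 ⟨b + 1, (hS _ (by omega)).1 hpb, by simp⟩)
  rw [← h.unique h', PowerSeries.coeff_mk]

end bridge

lemma G_prod (L : ℕ) : G L = ∏ k ∈ Finset.Icc 3 (L + 2), E k := by
  induction L with
  | zero => simp [G]
  | succ L ih => 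
    rw [G_succ, ih]
    exact (Finset.prod_Icc_succ_top (a := 3) (b := L + 2) (by omega) E).symm

lemma A_eq (L N : ℕ) (hL : 3 ≤ L) : (Nat.card {p : Nat.Partition N //
        2 ∈ p.parts ∧ (∀ i ∈ p.parts, 2 ≤ i ∧ i ≤ L + 2) ∧ p.parts.count (L + 1) = 0} : ℤ) = 
    PowerSeries.coeff N ((E 2 - 1) * (G L * (1 - X ^ (L + 1)))) := by
  classical
  set p1 : ℕ → Prop := fun i => 2 ≤ i ∧ i ≤ L + 2 ∧ i ≠ L + 1 with hp1
  set p2 : ℕ → Prop := fun i => 3 ≤ i ∧ i ≤ L + 2 ∧ i ≠ L + 1 with hp2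
  have c1 := card_restricted (insert 2 ((Finset.Icc 3 (L + 2)).erase (L + 1))) p1 
    (by intro i hi; simp [hp1]; omega) (by simp) N
  have c2 := card_restricted ((Finset.Icc 3 (L + 2)).erase (L + 1)) p2 
    (by intro i hi; simp [hp2]; omega) (by simp) N
  rw [Finset.prod_insert (by simp)] at c1
  have hK : ∏ k ∈ (Finset.Icc 3 (L + 2)).erase (L + 1), E k = G L * (1 - X ^ (L + 1)) := by
    rw [G_prod, ← Finset.prod_erase_mul _ _ (show L + 1 ∈ Finset.Icc 3 (L + 2) by simp; omega),
      mul_assoc, E_mul _ (by omega), mul_one]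
  rw [hK] at c1 c2
  have hsub : Nat.Partition.restricted N p2 ⊆ Nat.Partition.restricted N p1 := by
    intro q hq
    simp only [Nat.Partition.restricted, Finset.mem_filter, Finset.mem_univ, true_and, hp1, hp2] at hq ⊢
    intro i hi
    have := hq i hi
    omega
  rw [sub_mul, one_mul, map_sub, ← c1, ← c2, ← Nat.cast_sub (Finset.card_le_card hsub), 
    ← Finset.card_sdiff_of_subset hsub, Nat.card_eq_fintype_card, Fintype.card_subtype]
  congr 2
  ext q
  simp only [Nat.Partition.restricted, Finset.mem_filter, Finset.mem_univ, true_and, hp1, hp2,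
    Finset.mem_sdiff, Multiset.count_eq_zero]
  constructor
  · rintro ⟨h2, h, hc⟩
    refine ⟨fun i hi => ⟨(h i hi).1, (h i hi).2, fun e => hc (e ▸ hi)⟩, fun h' => ?_⟩
    have := (h' 2 h2).1
    omega
  · rintro ⟨h, h'⟩
    refine ⟨?_, fun i hi => ⟨(h i hi).1, (h i hi).2.1⟩, fun hc => (h _ hc).2.2 rfl⟩
    by_contra h2
    apply h'
    intro i hi
    have := h i hi
    have : i ≠ 2 := fun e => h2 (e ▸ hi)
    omega

lemma B_eq (L N : ℕ) (hN : 1 ≤ N) : (Nat.card {p : Nat.Partition N //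
        p.parts ≠ 0 ∧ ∀ i ∈ p.parts, 3 ≤ i ∧ i ≤ L + 2} : ℤ) = PowerSeries.coeff N (G L) := by
  classical
  rw [G_prod, ← card_restricted (Finset.Icc 3 (L + 2)) (fun i => 3 ≤ i ∧ i ≤ L + 2) 
    (by intro i hi; simp) (by simp) N, Nat.card_eq_fintype_card, Fintype.card_subtype]
  congr 2
  ext q
  simp only [Nat.Partition.restricted, Finset.mem_filter, Finset.mem_univ, true_and]
  constructor
  · exact fun h => h.2
  · refine fun h => ⟨fun h0 => ?_, h⟩
    have := q.parts_sum
    rw [h0] at this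
    simp at this
    omega

end BU

/-- **Theorem 3.2 (Berkovich–Uncu).** For `L ≥ 3` and `N ≥ 1`, the number of partitions of `N`
with smallest part `2`, all parts `≤ L+2`, and `L+1` not a part, plus the corrections
`δ_{N,3} + δ_{N,9}·δ_{L,4}`, is at least the number of nonempty partitions of `N` into parts
from `{3, …, L+2}`. -/
theorem stmt2 (L N : ℕ) (hL : 3 ≤ L) (hN : 1 ≤ N) :
    Nat.card {p : Nat.Partition N //
        2 ∈ p.parts ∧ (∀ i ∈ p.parts, 2 ≤ i ∧ i ≤ L + 2) ∧ p.parts.count (L + 1) = 0}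
      + (if N = 3 then 1 else 0) + (if N = 9 ∧ L = 4 then 1 else 0) ≥
    Nat.card {p : Nat.Partition N //
        p.parts ≠ 0 ∧ ∀ i ∈ p.parts, 3 ≤ i ∧ i ≤ L + 2} := by
  have hA := BU.A_eq L N hL
  have hB := BU.B_eq L N hN
  obtain ⟨m, rfl⟩ : ∃ m, L = m + 3 := ⟨L - 3, by omega⟩
  have hF := BU.coeff_F m N hN
  have key : BU.G (m + 3) - (BU.E 2 - 1) * (BU.G (m + 3) * (1 - PowerSeries.X ^ (m + 3 + 1)))
      = BU.F (m + 3) := by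
    simp only [BU.F, BU.Q]
    linear_combination (-BU.G (m + 3) * (2 - PowerSeries.X ^ (m + 4))) * BU.E_mul 2 (by omega)
  rw [← key, map_sub, ← hA, ← hB] at hF
  generalize Nat.card _ = a at *
  generalize Nat.card _ = b at *
  split_ifs at hF ⊢ <;> omega
end

section
/- The identity Σ_{n≥1} (q^n/(1+q^n)) · 1/(q;q)_{n−1} = Σ_{n≥1} q^{n(n+1)/2}/((q²;q²)_n (q^{n+1};q)_∞) holds for |q| < 1. -/
open Filter Topology

lemma qs_ne (q c : ℂ) (hq : ‖q‖ < 1) (hc : ‖c‖ = 1) (i : ℕ) : 1 + c * q ^ (i + 1) ≠ 0 := by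
  intro h
  have h1 : ‖c * q ^ (i + 1)‖ = 1 := by
    have : c * q ^ (i + 1) = -1 := by linear_combination h
    rw [this]; simp
  rw [norm_mul, hc, one_mul, norm_pow] at h1
  have := pow_lt_one₀ (norm_nonneg q) hq (Nat.succ_ne_zero i)
  simp only [Nat.succ_eq_add_one] at this
  linarith

lemma qs_summ (q c : ℂ) (hq : ‖q‖ < 1) (hc : ‖c‖ = 1) :
    Summable (fun i : ℕ => ‖c * q ^ (i + 1)‖) := by
  simp only [norm_mul, hc, one_mul, norm_pow]
  exact (summable_nat_add_iff 1).2 (summable_geometric_of_lt_one (norm_nonneg q) hq)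

lemma qs_mult (q c : ℂ) (hq : ‖q‖ < 1) (hc : ‖c‖ = 1) :
    Multipliable (fun i : ℕ => 1 + c * q ^ (i + 1)) :=
  multipliable_one_add_of_summable (qs_summ q c hq hc)

lemma qs_tprod_ne (q c : ℂ) (hq : ‖q‖ < 1) (hc : ‖c‖ = 1) :
    ∏' i : ℕ, (1 + c * q ^ (i + 1)) ≠ 0 :=
  tprod_one_add_ne_zero_of_summable (qs_ne q c hq hc) (qs_summ q c hq hc)

lemma qs_bdd (u : ℕ → ℂ) (a : ℂ) (h : Tendsto u atTop (𝓝 a)) :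
    ∃ C : ℝ, 0 ≤ C ∧ ∀ n, ‖u n‖ ≤ C := by
  obtain ⟨C, hC⟩ := h.norm.bddAbove_range
  exact ⟨C, (norm_nonneg _).trans (hC ⟨0, rfl⟩), fun n => hC ⟨n, rfl⟩⟩

/-- partial products `(-c q; q)_n` -/
noncomputable def qsP (q c : ℂ) (n : ℕ) : ℂ := ∏ i ∈ Finset.range n, (1 + c * q ^ (i + 1))

lemma qsP_zero (q c : ℂ) : qsP q c 0 = 1 := by simp [qsP]

lemma qsP_succ (q c : ℂ) (n : ℕ) : qsP q c (n + 1) = qsP q c n * (1 + c * q ^ (n + 1)) := by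
  simp [qsP, Finset.prod_range_succ]

lemma qsP_ne (q c : ℂ) (hq : ‖q‖ < 1) (hc : ‖c‖ = 1) (n : ℕ) : qsP q c n ≠ 0 :=
  Finset.prod_ne_zero_iff.2 fun i _ => qs_ne q c hq hc i

lemma qsP_tendsto (q c : ℂ) (hq : ‖q‖ < 1) (hc : ‖c‖ = 1) :
    Tendsto (qsP q c) atTop (𝓝 (∏' i : ℕ, (1 + c * q ^ (i + 1)))) :=
  (qs_mult q c hq hc).tendsto_prod_tprod_nat

lemma qsP_bdd (q c : ℂ) (hq : ‖q‖ < 1) (hc : ‖c‖ = 1) :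
    ∃ C : ℝ, 0 ≤ C ∧ ∀ n, ‖qsP q c n‖ ≤ C :=
  qs_bdd _ _ (qsP_tendsto q c hq hc)

lemma qsP_inv_bdd (q c : ℂ) (hq : ‖q‖ < 1) (hc : ‖c‖ = 1) :
    ∃ C : ℝ, 0 ≤ C ∧ ∀ n, ‖(qsP q c n)⁻¹‖ ≤ C :=
  qs_bdd _ _ ((qsP_tendsto q c hq hc).inv₀ (qs_tprod_ne q c hq hc))

/-- bounded times geometric -/
lemma qs_bg (q : ℂ) (hq : ‖q‖ < 1) (u : ℕ → ℂ) (C : ℝ) (hu : ∀ n, ‖u n‖ ≤ C) (k : ℕ) (n : ℕ) :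
    ‖u n * q ^ (n * (k + 1))‖ ≤ C * ‖q‖ ^ n := by
  rw [norm_mul, norm_pow]
  have h := pow_le_pow_of_le_one (norm_nonneg q) hq.le (show n ≤ n * (k + 1) by nlinarith)
  exact mul_le_mul (hu n) h (by positivity) ((norm_nonneg _).trans (hu n))

lemma qs_bsumm (q : ℂ) (hq : ‖q‖ < 1) (u : ℕ → ℂ) (C : ℝ) (hu : ∀ n, ‖u n‖ ≤ C) (k : ℕ) :
    Summable (fun n => u n * q ^ (n * (k + 1))) :=
  Summable.of_norm_bounded ((summable_geometric_of_lt_one (norm_nonneg q) hq).mul_left C)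
    (qs_bg q hq u C hu k)

/-- `E_k = Σ_m q^{m(k+1)}/(q;q)_m` -/
noncomputable def qsE (q : ℂ) (k : ℕ) : ℂ := ∑' m : ℕ, (qsP q (-1) m)⁻¹ * q ^ (m * (k + 1))

lemma qsE_succ (q : ℂ) (hq : ‖q‖ < 1) (k : ℕ) :
    qsE q (k + 1) = qsE q k * (1 + (-1) * q ^ (k + 1)) := by
  obtain ⟨C, hC0, hC⟩ := qsP_inv_bdd q (-1) hq (by simp)
  have s1 := qs_bsumm q hq _ C hC k
  have s2 := qs_bsumm q hq _ C hC (k + 1)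
  have h : qsE q k - qsE q (k + 1) = q ^ (k + 1) * qsE q k := by
    unfold qsE
    rw [← s1.tsum_sub s2, (s1.sub s2).tsum_eq_zero_add, ← tsum_mul_left]
    simp only [zero_mul, pow_zero, sub_self, zero_add]
    refine tsum_congr fun m => ?_
    have h1 := qsP_ne q (-1) hq (by simp) m
    have h2 := qs_ne q (-1) hq (by simp) m
    have h5 := inv_mul_cancel₀ h2
    rw [qsP_succ, mul_inv]
    linear_combination (qsP q (-1) m)⁻¹ * q ^ ((m + 1) * (k + 1)) * h5
  linear_combination -h

lemma qsE_eq (q : ℂ) (hq : ‖q‖ < 1) (k : ℕ) : qsE q k = qsE q 0 * qsP q (-1) k := by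
  induction k with
  | zero => simp [qsP_zero]
  | succ k ih => rw [qsE_succ q hq, ih, qsP_succ]; ring

lemma qsE_tendsto (q : ℂ) (hq : ‖q‖ < 1) : Tendsto (qsE q) atTop (𝓝 1) := by
  obtain ⟨C, hC0, hC⟩ := qsP_inv_bdd q (-1) hq (by simp)
  have := tendsto_tsum_of_dominated_convergence (𝓕 := atTop)
    (f := fun k m : ℕ => (qsP q (-1) m)⁻¹ * q ^ (m * (k + 1)))
    (g := fun m : ℕ => if m = 0 then (1 : ℂ) else 0)
    ((summable_geometric_of_lt_one (norm_nonneg q) hq).mul_left C) ?_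
    (Eventually.of_forall fun k => qs_bg q hq _ C hC k)
  · simp only [tsum_ite_eq] at this
    exact this
  · intro m
    rcases Nat.eq_zero_or_pos m with rfl | hm
    · simp [qsP_zero]
    · rw [if_neg hm.ne']
      have h1 : Tendsto (fun k : ℕ => m * (k + 1)) atTop atTop :=
        tendsto_atTop_mono (fun k => by simp only [id]; nlinarith) tendsto_id
      have h2 := (tendsto_pow_atTop_nhds_zero_of_norm_lt_one hq).comp h1
      simpa using h2.const_mul ((qsP q (-1) m)⁻¹)

lemma qsE_tprod (q : ℂ) (hq : ‖q‖ < 1) :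
    qsE q 0 * ∏' i : ℕ, (1 + (-1) * q ^ (i + 1)) = 1 := by
  refine tendsto_nhds_unique ?_ (qsE_tendsto q hq)
  have h := (qsP_tendsto q (-1) hq (by simp)).const_mul (qsE q 0)
  exact h.congr fun k => (qsE_eq q hq k).symm

/-- `G_n = Σ_k (q;q)_k (-q^{n+1})^k` -/
noncomputable def qsG (q : ℂ) (n : ℕ) : ℂ :=
  ∑' k : ℕ, (qsP q (-1) k * (-1) ^ k) * q ^ (k * (n + 1))

lemma qsG_bdd' (q : ℂ) (hq : ‖q‖ < 1) :
    ∃ C : ℝ, 0 ≤ C ∧ ∀ n, ‖qsP q (-1) n * (-1) ^ n‖ ≤ C := by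
  simpa using qsP_bdd q (-1) hq (by simp)

lemma qsG_rec (q : ℂ) (hq : ‖q‖ < 1) (n : ℕ) :
    (1 + 1 * q ^ (n + 1)) * qsG q n = 1 + q ^ (n + 2) * qsG q (n + 1) := by
  obtain ⟨C, hC0, hC⟩ := qsG_bdd' q hq
  have s1 := qs_bsumm q hq _ C hC n
  have s2 := qs_bsumm q hq _ C hC (n + 1)
  have e : qsG q n = 1 + ∑' k : ℕ, (qsP q (-1) (k + 1) * (-1) ^ (k + 1)) * q ^ ((k + 1) * (n + 1)) := by
    unfold qsG
    rw [s1.tsum_eq_zero_add]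
    simp [qsP_zero]
  have e2 : ∑' k : ℕ, (qsP q (-1) (k + 1) * (-1) ^ (k + 1)) * q ^ ((k + 1) * (n + 1))
      = q ^ (n + 2) * qsG q (n + 1) - q ^ (n + 1) * qsG q n := by
    unfold qsG
    rw [← tsum_mul_left, ← tsum_mul_left, ← (s2.mul_left _).tsum_sub (s1.mul_left _)]
    refine tsum_congr fun k => ?_
    rw [qsP_succ]
    ring
  linear_combination e + e2

lemma qsG_bdd (q : ℂ) (hq : ‖q‖ < 1) : ∃ C : ℝ, 0 ≤ C ∧ ∀ n, ‖qsG q n‖ ≤ C := by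
  obtain ⟨C, hC0, hC⟩ := qsG_bdd' q hq
  have hg := (summable_geometric_of_lt_one (norm_nonneg q) hq).mul_left C
  refine ⟨∑' n : ℕ, C * ‖q‖ ^ n, tsum_nonneg fun n => by positivity, fun n => ?_⟩
  exact tsum_of_norm_bounded hg.hasSum (qs_bg q hq _ C hC n)

lemma qs_tri (n : ℕ) : (n + 1 + 1) * (n + 1 + 2) / 2 = (n + 1) * (n + 2) / 2 + (n + 2) := by
  have : (n + 1 + 1) * (n + 1 + 2) = (n + 1) * (n + 2) + (n + 2) * 2 := by ring
  rw [this, Nat.add_mul_div_right _ _ (by norm_num)]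

lemma qs_tri_ge (n : ℕ) : n ≤ (n + 1) * (n + 2) / 2 := by
  induction n with
  | zero => simp
  | succ n ih => rw [qs_tri]; omega

lemma qs_partial (q : ℂ) (hq : ‖q‖ < 1) (N : ℕ) :
    q * qsG q 0 = ∑ n ∈ Finset.range N, q ^ ((n + 1) * (n + 2) / 2) * (qsP q 1 (n + 1))⁻¹
      + q ^ ((N + 1) * (N + 2) / 2) * (qsP q 1 N)⁻¹ * qsG q N := by
  induction N with
  | zero => simp [qsP_zero]
  | succ N ih =>
    rw [ih, Finset.sum_range_succ, add_assoc]
    congr 1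
    have h1 := qsP_ne q 1 hq (by simp) N
    have h2 := qs_ne q 1 hq (by simp) N
    have h3 := qsG_rec q hq N
    have h4 : qsG q N = (1 + 1 * q ^ (N + 1))⁻¹ * (1 + q ^ (N + 2) * qsG q (N + 1)) := by
      rw [← h3, inv_mul_cancel_left₀ h2]
    rw [h4, qsP_succ, qs_tri, mul_inv, pow_add q _ (N + 2)]
    ring

lemma qs_sigma (q : ℂ) (hq : ‖q‖ < 1) :
    ∑' n : ℕ, q ^ ((n + 1) * (n + 2) / 2) * (qsP q 1 (n + 1))⁻¹ = q * qsG q 0 := by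
  obtain ⟨C, hC0, hC⟩ := qsP_inv_bdd q 1 hq (by simp)
  obtain ⟨D, hD0, hD⟩ := qsG_bdd q hq
  have hp : ∀ n : ℕ, ‖q‖ ^ ((n + 1) * (n + 2) / 2) ≤ ‖q‖ ^ n := fun n =>
    pow_le_pow_of_le_one (norm_nonneg q) hq.le (qs_tri_ge n)
  have hg := summable_geometric_of_lt_one (norm_nonneg q) hq
  have hs : Summable fun n : ℕ => q ^ ((n + 1) * (n + 2) / 2) * (qsP q 1 (n + 1))⁻¹ := by
    refine Summable.of_norm_bounded (hg.mul_right C) fun n => ?_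
    rw [norm_mul, norm_pow]
    exact mul_le_mul (hp n) (hC _) (norm_nonneg _) (by positivity)
  have hr : Tendsto (fun N : ℕ => q ^ ((N + 1) * (N + 2) / 2) * (qsP q 1 N)⁻¹ * qsG q N)
      atTop (𝓝 0) := by
    refine squeeze_zero_norm (a := fun n => ‖q‖ ^ n * C * D) (fun n => ?_) ?_
    · rw [norm_mul, norm_mul, norm_pow]
      exact mul_le_mul (mul_le_mul (hp n) (hC _) (norm_nonneg _) (by positivity)) (hD _)
        (norm_nonneg _) (by positivity)
    · simpa using ((hg.tendsto_atTop_zero).mul_const C).mul_const D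
  have := hs.hasSum.tendsto_sum_nat.add hr
  rw [add_zero] at this
  refine tendsto_nhds_unique this ?_
  exact tendsto_const_nhds.congr fun N => qs_partial q hq N

lemma qs_lhs (q : ℂ) (hq : ‖q‖ < 1) :
    ∑' n : ℕ, q ^ (n + 1) / (1 + q ^ (n + 1)) * (qsP q (-1) n)⁻¹
      = qsE q 0 * (q * qsG q 0) := by
  obtain ⟨C, hC0, hC⟩ := qsP_inv_bdd q (-1) hq (by simp)
  have hg := summable_geometric_of_lt_one (norm_nonneg q) hq
  have hs : Summable (Function.uncurry fun n k : ℕ =>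
      (-1 : ℂ) ^ k * q ^ ((n + 1) * (k + 1)) * (qsP q (-1) n)⁻¹) := by
    refine Summable.of_norm_bounded ((hg.mul_of_nonneg hg (fun n => by positivity)
      (fun n => by positivity)).mul_right C) ?_
    rintro ⟨n, k⟩
    simp only [Function.uncurry, norm_mul, norm_pow, norm_neg, norm_one, one_pow, one_mul]
    refine mul_le_mul ?_ (hC n) (norm_nonneg _) (by positivity)
    rw [← pow_add]
    exact pow_le_pow_of_le_one (norm_nonneg q) hq.le (by nlinarith)
  calc _ = ∑' n : ℕ, ∑' k : ℕ, (-1 : ℂ) ^ k * q ^ ((n + 1) * (k + 1)) * (qsP q (-1) n)⁻¹ := by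
        refine tsum_congr fun n => ?_
        rw [tsum_mul_right]
        congr 1
        have h : ‖-q ^ (n + 1)‖ < 1 := by
          rw [norm_neg, norm_pow]
          exact pow_lt_one₀ (norm_nonneg q) hq (Nat.succ_ne_zero n)
        have := tsum_geometric_of_norm_lt_one h
        rw [sub_neg_eq_add] at this
        rw [div_eq_mul_inv, ← this, ← tsum_mul_left]
        refine tsum_congr fun k => ?_
        rw [neg_pow]
        ring
    _ = ∑' k : ℕ, ∑' n : ℕ, (-1 : ℂ) ^ k * q ^ ((n + 1) * (k + 1)) * (qsP q (-1) n)⁻¹ :=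
        hs.tsum_comm.symm
    _ = _ := by
        unfold qsG
        rw [← tsum_mul_left, ← tsum_mul_left]
        refine tsum_congr fun k => ?_
        have := qsE_eq q hq k
        calc _ = (-1 : ℂ) ^ k * q ^ (k + 1) * qsE q k := by
              unfold qsE
              rw [← tsum_mul_left]
              refine tsum_congr fun n => ?_
              ring
          _ = _ := by
              rw [this]; ring

/-- **Identity (1.4).** For `‖q‖ < 1`,
`Σ_{n ≥ 1} (q^n/(1+q^n)) / (q;q)_{n-1} = Σ_{n ≥ 1} q^{n(n+1)/2}/((q²;q²)_n (q^{n+1};q)_∞)`. -/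
theorem stmt8 (q : ℂ) (hq : ‖q‖ < 1) :
    ∑' n : ℕ, q ^ (n + 1) / (1 + q ^ (n + 1))
        * (∏ i ∈ Finset.range n, (1 - q ^ (i + 1)))⁻¹
      = ∑' n : ℕ, q ^ ((n + 1) * (n + 2) / 2)
        / ((∏ i ∈ Finset.range (n + 1), (1 - q ^ (2 * (i + 1))))
            * ∏' i : ℕ, (1 - q ^ ((n + 2) + i))) := by
  have hP : ∀ n, ∏ i ∈ Finset.range n, (1 - q ^ (i + 1)) = qsP q (-1) n := by
    intro n
    unfold qsP
    exact Finset.prod_congr rfl fun i _ => by ring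
  simp only [hP]
  rw [qs_lhs q hq, ← qs_sigma q hq, ← tsum_mul_left]
  refine tsum_congr fun n => ?_
  have h1 : ∏ i ∈ Finset.range (n + 1), (1 - q ^ (2 * (i + 1)))
      = qsP q 1 (n + 1) * qsP q (-1) (n + 1) := by
    unfold qsP
    rw [← Finset.prod_mul_distrib]
    exact Finset.prod_congr rfl fun i _ => by ring
  have hm : Multipliable (fun i : ℕ => 1 + (-1) * q ^ (i + (n + 1) + 1)) := by
    refine multipliable_one_add_of_summable ?_
    exact (summable_nat_add_iff (n + 1)).2 (qs_summ q (-1) hq (by simp))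
  have h2 : qsP q (-1) (n + 1) * ∏' i : ℕ, (1 - q ^ ((n + 2) + i))
      = ∏' i : ℕ, (1 + (-1) * q ^ (i + 1)) := by
    rw [← Multipliable.prod_mul_tprod_nat_mul' (f := fun i : ℕ => 1 + (-1) * q ^ (i + 1))
      (k := n + 1) hm]
    unfold qsP
    congr 1
    refine tprod_congr fun i => ?_
    ring
  have h3 := qsE_tprod q hq
  rw [h1, mul_assoc, h2, eq_inv_of_mul_eq_one_left h3, div_eq_mul_inv, mul_inv]
  ring
end
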